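/- Let A be a non-empty finite subset of F_2^n with |A + A| ≤ K|A| for some real K ≥ 1. Then there exists a subgroup H of F_2^n with |H| ≤ |A| such that A is covered by at most 2K^12 cosets of H. -/

import Mathlib

open scoped Pointwise

noncomputable section PFR
set_option linter.unusedSectionVars false
open Classical Real

variable {Ω S T U : Type*} [Fintype Ω]

/-- Probability that `X = s`. -/
def mm (μ : Ω → ℝ) (X : Ω → S) (s : S) : ℝ := ∑ ω, if X ω = s then μ ω else 0

/-- Shannon entropy of `X`. -/
def HH (μ : Ω → ℝ) (X : Ω → S) : ℝ := ∑ ω, μ ω * (-log (mm μ X (X ω)))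

def IsPr (μ : Ω → ℝ) : Prop := (∀ ω, 0 ≤ μ ω) ∧ ∑ ω, μ ω = 1

def Ent (p : Ω → ℝ) : ℝ := ∑ x, negMulLog (p x)

lemma mm_nonneg {μ : Ω → ℝ} (h : IsPr μ) (X : Ω → S) (s : S) : 0 ≤ mm μ X s :=
  Finset.sum_nonneg fun ω _ => by split_ifs; exacts [h.1 ω, le_rfl]

lemma mm_pos {μ : Ω → ℝ} (h : IsPr μ) (X : Ω → S) {ω : Ω} (hω : μ ω ≠ 0) :
    0 < mm μ X (X ω) := by
  have h1 : (if X ω = X ω then μ ω else 0) ≤ mm μ X (X ω) :=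
    Finset.single_le_sum (f := fun ω' => if X ω' = X ω then μ ω' else 0)
      (fun ω' _ => by split_ifs; exacts [h.1 ω', le_rfl]) (Finset.mem_univ ω)
  have h2 : 0 < μ ω := lt_of_le_of_ne (h.1 ω) (Ne.symm hω)
  simp at h1; linarith

lemma sum_mm [Fintype S] (μ : Ω → ℝ) (X : Ω → S) (g : S → ℝ) :
    ∑ s, mm μ X s * g s = ∑ ω, μ ω * g (X ω) := by
  simp only [mm, Finset.sum_mul]
  rw [Finset.sum_comm]
  refine Finset.sum_congr rfl fun ω _ => ?_
  simp [ite_mul]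

lemma isPr_mm [Fintype S] {μ : Ω → ℝ} (h : IsPr μ) (X : Ω → S) : IsPr (mm μ X) :=
  ⟨mm_nonneg h X, by simpa [h.2] using sum_mm μ X (fun _ => 1)⟩

lemma HH_eq [Fintype S] (μ : Ω → ℝ) (X : Ω → S) : HH μ X = Ent (mm μ X) := by
  rw [HH, ← sum_mm μ X (fun s => -log (mm μ X s)), Ent]
  refine Finset.sum_congr rfl fun s _ => ?_
  simp [negMulLog]

lemma mm_comp [Fintype S] (μ : Ω → ℝ) (X : Ω → S) (f : S → T) (t : T) :
    mm μ (fun ω => f (X ω)) t = mm (mm μ X) f t := by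
  have := sum_mm μ X (fun s => if f s = t then 1 else 0)
  simp only [mul_ite, mul_one, mul_zero] at this
  exact this.symm

lemma mm_marg [Fintype T] (μ : Ω → ℝ) (X : Ω → S) (Y : Ω → T) (s : S) :
    ∑ t, mm μ (fun ω => (X ω, Y ω)) (s, t) = mm μ X s := by
  simp only [mm, Prod.mk.injEq]
  rw [Finset.sum_comm]
  refine Finset.sum_congr rfl fun ω _ => ?_
  by_cases h : X ω = s <;> simp [h]

lemma mm_iff {μ : Ω → ℝ} {X : Ω → S} {Y : Ω → T} {s : S} {t : T}
    (h : ∀ ω, X ω = s ↔ Y ω = t) : mm μ X s = mm μ Y t := by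
  simp only [mm, h]

lemma HH_congr {μ : Ω → ℝ} {X : Ω → S} {Y : Ω → T}
    (h : ∀ ω ω', μ ω ≠ 0 → μ ω' ≠ 0 → (X ω = X ω' ↔ Y ω = Y ω')) : HH μ X = HH μ Y := by
  refine Finset.sum_congr rfl fun ω _ => ?_
  by_cases hω : μ ω = 0
  · simp [hω]
  congr 3
  refine Finset.sum_congr rfl fun ω' _ => ?_
  by_cases hω' : μ ω' = 0
  · simp [hω']
  simp only [h ω' ω hω' hω]

lemma HH_const {μ : Ω → ℝ} (h : IsPr μ) (X : Ω → S) (hX : ∀ ω ω', X ω = X ω') : HH μ X = 0 := by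
  refine Finset.sum_eq_zero fun ω _ => ?_
  have : mm μ X (X ω) = 1 := by simp [mm, hX _ ω, h.2]
  simp [this]

def CI (μ : Ω → ℝ) (X : Ω → S) (Y : Ω → T) (C : Ω → U) : Prop :=
  ∀ x y c, mm μ (fun ω => (X ω, Y ω, C ω)) (x, y, c) * mm μ C c =
    mm μ (fun ω => (X ω, C ω)) (x, c) * mm μ (fun ω => (Y ω, C ω)) (y, c)

def Ind (μ : Ω → ℝ) (X : Ω → S) (Y : Ω → T) : Prop :=
  ∀ x y, mm μ (fun ω => (X ω, Y ω)) (x, y) = mm μ X x * mm μ Y y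

lemma CI.HH {μ : Ω → ℝ} (h : IsPr μ) {X : Ω → S} {Y : Ω → T} {C : Ω → U} (hc : CI μ X Y C) :
    HH μ (fun ω => (X ω, Y ω, C ω)) + HH μ C =
      HH μ (fun ω => (X ω, C ω)) + HH μ (fun ω => (Y ω, C ω)) := by
  simp only [_root_.HH, ← Finset.sum_add_distrib]
  refine Finset.sum_congr rfl fun ω _ => ?_
  by_cases hω : μ ω = 0
  · simp [hω]
  have h1 := mm_pos h (fun ω => (X ω, Y ω, C ω)) hω
  have h2 := mm_pos h C hω
  have h3 := mm_pos h (fun ω => (X ω, C ω)) hω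
  have h4 := mm_pos h (fun ω => (Y ω, C ω)) hω
  have := congrArg log (hc (X ω) (Y ω) (C ω))
  rw [log_mul h1.ne' h2.ne', log_mul h3.ne' h4.ne'] at this
  linear_combination (-μ ω) * this

lemma Ind.HH {μ : Ω → ℝ} (h : IsPr μ) {X : Ω → S} {Y : Ω → T} (hc : Ind μ X Y) :
    HH μ (fun ω => (X ω, Y ω)) = HH μ X + HH μ Y := by
  simp only [_root_.HH, ← Finset.sum_add_distrib]
  refine Finset.sum_congr rfl fun ω _ => ?_
  by_cases hω : μ ω = 0
  · simp [hω]
  have h2 := mm_pos h X hω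
  have h4 := mm_pos h Y hω
  have := congrArg log (hc (X ω) (Y ω))
  rw [log_mul h2.ne' h4.ne'] at this
  linear_combination (-μ ω) * this

lemma submod [Fintype S] [Fintype T] [Fintype U] {μ : Ω → ℝ} (h : IsPr μ)
    (X : Ω → S) (Y : Ω → T) (C : Ω → U) :
    HH μ (fun ω => (X ω, Y ω, C ω)) + HH μ C ≤
      HH μ (fun ω => (X ω, C ω)) + HH μ (fun ω => (Y ω, C ω)) := by
  set a := mm μ (fun ω => (X ω, C ω)) with ha
  set b := mm μ (fun ω => (Y ω, C ω)) with hb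
  set e := mm μ (fun ω => (X ω, Y ω, C ω)) with he
  set g := mm μ C with hg
  have key : ∑ ω, μ ω * (a (X ω, C ω) * b (Y ω, C ω) / (e (X ω, Y ω, C ω) * g (C ω)) - 1) ≤ 0 := by
    have e1 := sum_mm μ (fun ω => (X ω, Y ω, C ω))
      (fun s => a (s.1, s.2.2) * b (s.2.1, s.2.2) / (e s * g s.2.2) - 1)
    dsimp only at e1
    rw [← e1, ← he]
    have e2 : ∀ s : S × T × U, e s * (a (s.1, s.2.2) * b (s.2.1, s.2.2) / (e s * g s.2.2) - 1) ≤
        a (s.1, s.2.2) * b (s.2.1, s.2.2) / g s.2.2 - e s := by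
      intro s
      have p1 : 0 ≤ a (s.1, s.2.2) * b (s.2.1, s.2.2) / g s.2.2 :=
        div_nonneg (mul_nonneg (mm_nonneg h _ _) (mm_nonneg h _ _)) (mm_nonneg h _ _)
      by_cases h0 : e s = 0
      · simpa [h0] using p1
      · apply le_of_eq
        rw [mul_sub, mul_one, mul_div_assoc', mul_div_mul_left _ _ h0]
    refine (Finset.sum_le_sum fun s _ => e2 s).trans ?_
    rw [Finset.sum_sub_distrib, (isPr_mm h _).2, Fintype.sum_prod_type]
    simp only [Fintype.sum_prod_type]
    have e3 : ∑ x, ∑ y, ∑ c, a (x, c) * b (y, c) / g c = ∑ c, g c := by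
      have : ∀ c, g c = ∑ x, ∑ y, a (x, c) * b (y, c) / g c := by
        intro c
        have m1 : ∑ x, a (x, c) = g c := by
          rw [hg, ← mm_marg μ C X]
          exact Finset.sum_congr rfl fun x _ => mm_iff fun ω => by simp [and_comm]
        have m2 : ∑ y, b (y, c) = g c := by
          rw [hg, ← mm_marg μ C Y]
          exact Finset.sum_congr rfl fun x _ => mm_iff fun ω => by simp [and_comm]
        simp only [← Finset.sum_div, ← Finset.mul_sum, ← Finset.sum_mul, m1, m2]
        by_cases h0 : g c = 0
        · simp [h0]
        · field_simp
      have e4 : ∀ x, ∑ y, ∑ c, a (x, c) * b (y, c) / g c = ∑ c, ∑ y, a (x, c) * b (y, c) / g c :=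
        fun x => Finset.sum_comm
      simp only [e4]
      rw [Finset.sum_comm]
      exact Finset.sum_congr rfl fun c _ => (this c).symm
    rw [e3, (isPr_mm h _).2]; simp
  have : HH μ (fun ω => (X ω, Y ω, C ω)) + HH μ C -
      (HH μ (fun ω => (X ω, C ω)) + HH μ (fun ω => (Y ω, C ω))) ≤ 0 := by
    refine le_trans ?_ key
    simp only [_root_.HH, ← Finset.sum_add_distrib, ← Finset.sum_sub_distrib]
    refine Finset.sum_le_sum fun ω _ => ?_
    by_cases hω : μ ω = 0
    · simp [hω]
    have h1 := mm_pos h (fun ω => (X ω, Y ω, C ω)) hω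
    have h2 := mm_pos h C hω
    have h3 := mm_pos h (fun ω => (X ω, C ω)) hω
    have h4 := mm_pos h (fun ω => (Y ω, C ω)) hω
    have := log_le_sub_one_of_pos (div_pos (mul_pos h3 h4) (mul_pos h1 h2))
    rw [log_div (mul_pos h3 h4).ne' (mul_pos h1 h2).ne', log_mul h3.ne' h4.ne',
      log_mul h1.ne' h2.ne'] at this
    have := mul_le_mul_of_nonneg_left this (h.1 ω)
    refine le_trans (le_of_eq ?_) this
    ring
  linarith

lemma subadd [Fintype S] [Fintype T] {μ : Ω → ℝ} (h : IsPr μ) (X : Ω → S) (Y : Ω → T) :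
    HH μ (fun ω => (X ω, Y ω)) ≤ HH μ X + HH μ Y := by
  have h1 := submod h X Y (fun _ => ())
  rw [HH_const h (fun _ => ()) (by simp)] at h1
  rw [HH_congr (X := fun ω => (X ω, Y ω, ())) (Y := fun ω => (X ω, Y ω)) (by simp),
    HH_congr (X := fun ω => (X ω, ())) (Y := X) (by simp),
    HH_congr (X := fun ω => (Y ω, ())) (Y := Y) (by simp)] at h1
  linarith

lemma Ind.comp [Fintype S] [Fintype T] {S' T' : Type*} {μ : Ω → ℝ} {X : Ω → S} {Y : Ω → T}
    (hc : Ind μ X Y) (f : S → S') (g : T → T') : Ind μ (fun ω => f (X ω)) (fun ω => g (Y ω)) := by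
  intro a b
  rw [mm_comp μ X f, mm_comp μ Y g, mm_comp μ (fun ω => (X ω, Y ω)) (fun s => (f s.1, g s.2))]
  simp only [mm, Fintype.sum_prod_type, Finset.sum_mul_sum]
  refine Finset.sum_congr rfl fun x _ => Finset.sum_congr rfl fun y _ => ?_
  have := hc x y
  simp only [mm] at this
  rw [this]
  by_cases h1 : f x = a <;> by_cases h2 : g y = b <;> simp [h1, h2]

lemma Ind.ci [Fintype S] [Fintype T] {S' T' V W : Type*} {μ : Ω → ℝ} {X : Ω → S} {Y : Ω → T}
    (hc : Ind μ X Y) (f : S → S') (g : T → T') (u : S → V) (v : T → W) :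
    CI μ (fun ω => f (X ω)) (fun ω => g (Y ω)) (fun ω => (u (X ω), v (Y ω))) := by
  rintro x y ⟨c, d⟩
  have h1 := hc.comp (fun s => (f s, u s)) (fun s => (g s, v s)) (x, c) (y, d)
  have h2 := hc.comp u v c d
  have h3 := hc.comp (fun s => (f s, u s)) v (x, c) d
  have h4 := hc.comp u (fun s => (g s, v s)) c (y, d)
  rw [h2, mm_iff (X := fun ω => (f (X ω), g (Y ω), u (X ω), v (Y ω)))
    (Y := fun ω => ((f (X ω), u (X ω)), (g (Y ω), v (Y ω)))) (t := ((x, c), (y, d)))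
    (by intro ω; simp only [Prod.mk.injEq]; tauto), h1,
    mm_iff (X := fun ω => (f (X ω), u (X ω), v (Y ω)))
    (Y := fun ω => ((f (X ω), u (X ω)), (v (Y ω)))) (t := ((x, c), d))
    (by intro ω; simp only [Prod.mk.injEq]; tauto), h3,
    mm_iff (X := fun ω => (g (Y ω), u (X ω), v (Y ω)))
    (Y := fun ω => (u (X ω), (g (Y ω), (v (Y ω))))) (t := (c, (y, d)))
    (by intro ω; simp only [Prod.mk.injEq]; tauto), h4]
  ring

variable {G : Type*} [CommRing G] [Fintype G]

/-- Convolution. -/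
def cv (p q : G → ℝ) (s : G) : ℝ := ∑ y, p y * q (s - y)

lemma Ind.cv {μ : Ω → ℝ} {X Y : Ω → G} (hc : Ind μ X Y) :
    mm μ (fun ω => X ω + Y ω) = cv (mm μ X) (mm μ Y) := by
  funext s
  rw [mm_comp μ (fun ω => (X ω, Y ω)) (fun s => s.1 + s.2)]
  rw [mm, Fintype.sum_prod_type]
  refine Finset.sum_congr rfl fun x _ => ?_
  rw [Finset.sum_eq_single (s - x)]
  · simp [hc x (s - x)]
  · intro y _ hy
    rw [if_neg]
    rintro rfl; simp at hy
  · simp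

lemma isPr_cv {p q : G → ℝ} (hp : IsPr p) (hq : IsPr q) : IsPr (cv p q) := by
  refine ⟨fun s => Finset.sum_nonneg fun y _ => mul_nonneg (hp.1 _) (hq.1 _), ?_⟩
  simp only [cv]
  rw [Finset.sum_comm]
  simp only [← Finset.mul_sum]
  rw [← hp.2]
  refine Finset.sum_congr rfl fun y _ => ?_
  have := (Equiv.subRight y).sum_comp q
  simp only [Equiv.subRight_apply] at this
  rw [this, hq.2, mul_one]

def tau (r : G → ℝ) (η : ℝ) (p q : G → ℝ) : ℝ :=
  Ent (cv p q) - Ent p / 2 - Ent q / 2 +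
    η * ((Ent (cv r p) - Ent r / 2 - Ent p / 2) + (Ent (cv r q) - Ent r / 2 - Ent q / 2))

lemma mm_pair_le {μ : Ω → ℝ} (h : IsPr μ) (X : Ω → S) (C : Ω → T) (x : S) (c : T) :
    mm μ (fun ω => (X ω, C ω)) (x, c) ≤ mm μ C c := by
  refine Finset.sum_le_sum fun ω _ => ?_
  have := h.1 ω
  by_cases h1 : X ω = x <;> by_cases h2 : C ω = c <;> simp [h1, h2, this]

lemma mm_marg' [Fintype T] (μ : Ω → ℝ) (X : Ω → S) (Y : Ω → T) (s : S) :
    ∑ t, mm μ (fun ω => (Y ω, X ω)) (t, s) = mm μ X s := by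
  rw [← mm_marg μ X Y]
  exact Finset.sum_congr rfl fun x _ => mm_iff fun ω => by simp [and_comm]

def cnd (μ : Ω → ℝ) (X : Ω → S) (C : Ω → T) (c : T) (x : S) : ℝ :=
  mm μ (fun ω => (X ω, C ω)) (x, c) / mm μ C c

lemma isPr_cnd [Fintype S] {μ : Ω → ℝ} (h : IsPr μ) (X : Ω → S) (C : Ω → T) {c : T}
    (hc : mm μ C c ≠ 0) : IsPr (cnd μ X C c) := by
  refine ⟨fun x => div_nonneg (mm_nonneg h _ _) (mm_nonneg h _ _), ?_⟩
  simp only [cnd]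
  rw [← Finset.sum_div, mm_marg', div_self hc]

lemma mul_cnd {μ : Ω → ℝ} (h : IsPr μ) (X : Ω → S) (C : Ω → T) (c : T) (x : S) :
    mm μ C c * cnd μ X C c x = mm μ (fun ω => (X ω, C ω)) (x, c) := by
  by_cases hc : mm μ C c = 0
  · have := mm_pair_le h X C x c
    have h0 := mm_nonneg h (fun ω => (X ω, C ω)) (x, c)
    rw [hc] at *; linarith
  · simp only [cnd]; field_simp

lemma ent_cnd [Fintype S] [Fintype T] {μ : Ω → ℝ} (h : IsPr μ) (X : Ω → S) (C : Ω → T) :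
    ∑ c, mm μ C c * Ent (cnd μ X C c) = HH μ (fun ω => (X ω, C ω)) - HH μ C := by
  rw [HH_eq, HH_eq, Ent, Ent, Fintype.sum_prod_type, Finset.sum_comm, ← Finset.sum_sub_distrib]
  refine Finset.sum_congr rfl fun c _ => ?_
  by_cases hc : mm μ C c = 0
  · rw [hc]
    have : ∀ x, mm μ (fun ω => (X ω, C ω)) (x, c) = 0 := fun x => by
      rw [← mul_cnd h, hc, zero_mul]
    simp [this]
  have e : ∀ x, negMulLog (mm μ (fun ω => (X ω, C ω)) (x, c)) =
      cnd μ X C c x * negMulLog (mm μ C c) + mm μ C c * negMulLog (cnd μ X C c x) := fun x => by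
    rw [← mul_cnd h, negMulLog_mul]
  simp only [e, Finset.sum_add_distrib, ← Finset.sum_mul, ← Finset.mul_sum, (isPr_cnd h X C hc).2]
  simp [Ent]

lemma ent_cv_cnd [Fintype T] {μ : Ω → ℝ} (h : IsPr μ) (X : Ω → G) (C : Ω → T)
    {r : G → ℝ} (hr : IsPr r) :
    ∑ c, mm μ C c * Ent (cv r (cnd μ X C c)) ≤ Ent (cv r (mm μ X)) := by
  simp only [Ent, Finset.mul_sum]
  rw [Finset.sum_comm]
  refine Finset.sum_le_sum fun s _ => ?_
  have := concaveOn_negMulLog.le_map_sum (t := Finset.univ) (w := mm μ C)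
    (p := fun c => cv r (cnd μ X C c) s) (fun c _ => mm_nonneg h _ _) (isPr_mm h C).2
    (fun c _ => Finset.sum_nonneg fun y _ => mul_nonneg (hr.1 _)
      (div_nonneg (mm_nonneg h _ _) (mm_nonneg h _ _)))
  simp only [smul_eq_mul] at this
  refine this.trans (le_of_eq ?_)
  congr 1
  simp only [cv, Finset.mul_sum]
  rw [Finset.sum_comm]
  refine Finset.sum_congr rfl fun y _ => ?_
  rw [← mm_marg' μ X C, ]
  rw [Finset.mul_sum]
  refine Finset.sum_congr rfl fun c _ => ?_
  rw [mul_left_comm, mul_cnd h]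
  congr 1
  exact mm_iff fun ω => by simp [and_comm]

lemma CI.cv {μ : Ω → ℝ} {X Y : Ω → G} {C : Ω → T} (hc : CI μ X Y C) {c : T}
    (h0 : mm μ C c ≠ 0) :
    cv (cnd μ X C c) (cnd μ Y C c) = cnd μ (fun ω => X ω + Y ω) C c := by
  funext s
  have e : mm μ (fun ω => (X ω + Y ω, C ω)) (s, c) =
      ∑ y, mm μ (fun ω => (X ω, Y ω, C ω)) (y, s - y, c) := by
    simp only [mm]
    rw [Finset.sum_comm]
    refine Finset.sum_congr rfl fun ω _ => ?_
    rw [Finset.sum_eq_single (X ω)]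
    · simp [eq_sub_iff_add_eq, add_comm]
    · intro b _ hb
      simp [Ne.symm hb]
    · simp
  simp only [_root_.cv, cnd]
  rw [e, Finset.sum_div]
  refine Finset.sum_congr rfl fun y _ => ?_
  have := hc y (s - y) c
  field_simp
  linear_combination -this

lemma master [Fintype T] {r : G → ℝ} (hr : IsPr r) {η τ : ℝ} (hη : 0 ≤ η)
    (hτ : ∀ p q, IsPr p → IsPr q → τ ≤ tau r η p q)
    {μ : Ω → ℝ} (h : IsPr μ) {X Y : Ω → G} {C : Ω → T} (hc : CI μ X Y C) :
    τ ≤ (HH μ (fun ω => (X ω + Y ω, C ω)) - HH μ C)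
      - (HH μ (fun ω => (X ω, C ω)) - HH μ C) / 2
      - (HH μ (fun ω => (Y ω, C ω)) - HH μ C) / 2
      + η * ((Ent (cv r (mm μ X)) - Ent r / 2 - (HH μ (fun ω => (X ω, C ω)) - HH μ C) / 2) +
        (Ent (cv r (mm μ Y)) - Ent r / 2 - (HH μ (fun ω => (Y ω, C ω)) - HH μ C) / 2)) := by
  have h1 : τ ≤ ∑ c, mm μ C c * tau r η (cnd μ X C c) (cnd μ Y C c) := by
    have : τ = ∑ c, mm μ C c * τ := by rw [← Finset.sum_mul, (isPr_mm h C).2, one_mul]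
    rw [this]
    refine Finset.sum_le_sum fun c _ => ?_
    by_cases h0 : mm μ C c = 0
    · simp [h0]
    · exact mul_le_mul_of_nonneg_left (hτ _ _ (isPr_cnd h X C h0) (isPr_cnd h Y C h0))
        (mm_nonneg h _ _)
  have h2 : ∑ c, mm μ C c * tau r η (cnd μ X C c) (cnd μ Y C c) =
      ∑ c, mm μ C c * Ent (cnd μ (fun ω => X ω + Y ω) C c)
      - (∑ c, mm μ C c * Ent (cnd μ X C c)) / 2 - (∑ c, mm μ C c * Ent (cnd μ Y C c)) / 2
      + η * ((∑ c, mm μ C c * Ent (cv r (cnd μ X C c)) - (∑ c, mm μ C c) * Ent r / 2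
          - (∑ c, mm μ C c * Ent (cnd μ X C c)) / 2) +
        (∑ c, mm μ C c * Ent (cv r (cnd μ Y C c)) - (∑ c, mm μ C c) * Ent r / 2
          - (∑ c, mm μ C c * Ent (cnd μ Y C c)) / 2)) := by
    simp only [Finset.sum_div, Finset.mul_sum, Finset.sum_mul, ← Finset.sum_sub_distrib,
      ← Finset.sum_add_distrib]
    refine Finset.sum_congr rfl fun c _ => ?_
    by_cases h0 : mm μ C c = 0
    · simp [h0]
    · rw [tau, hc.cv h0]; ring
  rw [h2, ent_cnd h, ent_cnd h, ent_cnd h, (isPr_mm h C).2] at h1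
  have h3 := mul_le_mul_of_nonneg_left (ent_cv_cnd h X C hr) hη
  have h4 := mul_le_mul_of_nonneg_left (ent_cv_cnd h Y C hr) hη
  linarith

lemma mm_iff' {μ : Ω → ℝ} {X : Ω → S} {Y : Ω → T} {s : S} {t : T}
    (h : ∀ ω, μ ω ≠ 0 → (X ω = s ↔ Y ω = t)) : mm μ X s = mm μ Y t := by
  refine Finset.sum_congr rfl fun ω _ => ?_
  by_cases h0 : μ ω = 0
  · simp [h0]
  · simp only [h ω h0]

lemma master0 {r : G → ℝ} {η τ : ℝ}
    (hτ : ∀ p q, IsPr p → IsPr q → τ ≤ tau r η p q)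
    {μ : Ω → ℝ} (h : IsPr μ) {X Y : Ω → G} (hi : Ind μ X Y) :
    τ ≤ HH μ (fun ω => X ω + Y ω) - HH μ X / 2 - HH μ Y / 2
      + η * ((Ent (cv r (mm μ X)) - Ent r / 2 - HH μ X / 2) +
        (Ent (cv r (mm μ Y)) - Ent r / 2 - HH μ Y / 2)) := by
  have h1 := hτ _ _ (isPr_mm h X) (isPr_mm h Y)
  rw [tau, ← hi.cv, ← HH_eq, ← HH_eq, ← HH_eq] at h1
  exact h1

/-- Two copies, conditionally independent over `C`. -/
def dbl (μ : Ω → ℝ) (C : Ω → T) (w : Ω × Ω) : ℝ :=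
  if C w.1 = C w.2 then μ w.1 * μ w.2 / mm μ C (C w.1) else 0

lemma dbl_ne {μ : Ω → ℝ} {C : Ω → T} {w : Ω × Ω} (h : dbl μ C w ≠ 0) : C w.1 = C w.2 := by
  by_contra h1; simp [dbl, h1] at h

lemma dbl_fst {μ : Ω → ℝ} (h : IsPr μ) (C : Ω → T) (ω : Ω) : ∑ ω', dbl μ C (ω, ω') = μ ω := by
  have : ∀ ω', dbl μ C (ω, ω') = (if C ω' = C ω then μ ω' else 0) * (μ ω / mm μ C (C ω)) := by
    intro ω'
    by_cases h1 : C ω' = C ω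
    · simp [dbl, h1]; ring
    · simp [dbl, h1, Ne.symm h1]
  simp only [this, ← Finset.sum_mul]
  by_cases h0 : μ ω = 0
  · simp [h0]
  · have := (mm_pos h C h0).ne'
    change mm μ C (C ω) * _ = _
    field_simp

lemma dbl_symm (μ : Ω → ℝ) (C : Ω → T) (ω ω' : Ω) : dbl μ C (ω, ω') = dbl μ C (ω', ω) := by
  by_cases h1 : C ω = C ω'
  · simp [dbl, h1, mul_comm]
  · simp [dbl, h1, Ne.symm h1]

lemma dbl_pr {μ : Ω → ℝ} (h : IsPr μ) (C : Ω → T) : IsPr (dbl μ C) := by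
  constructor
  · intro w
    rw [dbl]; split_ifs
    · exact div_nonneg (mul_nonneg (h.1 _) (h.1 _)) (mm_nonneg h _ _)
    · exact le_rfl
  · rw [Fintype.sum_prod_type]; simp only [dbl_fst h, h.2]

lemma dbl_mm_fst {μ : Ω → ℝ} (h : IsPr μ) (C : Ω → T) (X : Ω → S) :
    mm (dbl μ C) (fun w => X w.1) = mm μ X := by
  funext s
  rw [mm, Fintype.sum_prod_type]
  refine Finset.sum_congr rfl fun ω _ => ?_
  by_cases h1 : X ω = s <;> simp [h1, dbl_fst h]

lemma dbl_mm_snd {μ : Ω → ℝ} (h : IsPr μ) (C : Ω → T) (X : Ω → S) :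
    mm (dbl μ C) (fun w => X w.2) = mm μ X := by
  funext s
  rw [mm, Fintype.sum_prod_type_right]
  refine Finset.sum_congr rfl fun ω _ => ?_
  simp only [dbl_symm μ C _ ω]
  by_cases h1 : X ω = s <;> simp [h1, dbl_fst h]

lemma dbl_HH_fst {μ : Ω → ℝ} (h : IsPr μ) (C : Ω → T) (X : Ω → S) :
    HH (dbl μ C) (fun w => X w.1) = HH μ X := by
  rw [HH, dbl_mm_fst h, Fintype.sum_prod_type]
  simp only [← Finset.sum_mul, dbl_fst h, HH]

lemma dbl_HH_snd {μ : Ω → ℝ} (h : IsPr μ) (C : Ω → T) (X : Ω → S) :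
    HH (dbl μ C) (fun w => X w.2) = HH μ X := by
  rw [HH, dbl_mm_snd h, Fintype.sum_prod_type_right]
  rw [HH]
  refine Finset.sum_congr rfl fun ω _ => ?_
  dsimp only
  rw [← Finset.sum_mul]
  simp only [dbl_symm μ C _ ω]
  rw [dbl_fst h]

lemma dbl_ci {μ : Ω → ℝ} (h : IsPr μ) (C : Ω → T) (X : Ω → S) (Y : Ω → U) :
    CI (dbl μ C) (fun w => X w.1) (fun w => Y w.2) (fun w => C w.1) := by
  intro x y c
  rw [dbl_mm_fst h C C, dbl_mm_fst h C (fun ω => (X ω, C ω)),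
    mm_iff' (X := fun w : Ω × Ω => (Y w.2, C w.1)) (Y := fun w => (Y w.2, C w.2)) (t := (y, c))
    (by intro w hw; rw [dbl_ne hw]), dbl_mm_snd h C (fun ω => (Y ω, C ω))]
  by_cases h0 : mm μ C c = 0
  · have h1 := mm_pair_le h X C x c
    have h2 := mm_nonneg h (fun ω => (X ω, C ω)) (x, c)
    have h3 : mm μ (fun ω => (X ω, C ω)) (x, c) = 0 := by linarith
    simp [h0, h3]
  have : mm (dbl μ C) (fun w => (X w.1, Y w.2, C w.1)) (x, y, c) =
      mm μ (fun ω => (X ω, C ω)) (x, c) * mm μ (fun ω => (Y ω, C ω)) (y, c) / mm μ C c := by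
    simp only [mm.eq_1 (dbl μ C), mm.eq_1 μ (fun ω => (X ω, C ω)), mm.eq_1 μ (fun ω => (Y ω, C ω)),
      Finset.sum_mul_sum, Finset.sum_div, Fintype.sum_prod_type]
    refine Finset.sum_congr rfl fun ω _ => Finset.sum_congr rfl fun ω' _ => ?_
    by_cases a1 : X ω = x <;> by_cases a2 : C ω = c <;> by_cases a3 : Y ω' = y <;>
      by_cases a4 : C ω' = c <;> simp [dbl, a1, a2, a3, a4, Ne.symm]
  rw [this]; field_simp

lemma bsg (h2 : (2 : G) = 0) {r : G → ℝ} (hr : IsPr r) {η τ : ℝ} (hη : 0 ≤ η)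
    (hτ : ∀ p q, IsPr p → IsPr q → τ ≤ tau r η p q)
    {μ : Ω → ℝ} (h : IsPr μ) (A B S : Ω → G) {Q HC HAS HBS HS : ℝ}
    (hQ : HH μ (fun ω => (A ω, B ω, S ω)) = Q) (hC : HH μ (fun ω => (A ω + B ω, S ω)) = HC)
    (hAS : HH μ (fun ω => (A ω, S ω)) = HAS) (hBS : HH μ (fun ω => (B ω, S ω)) = HBS)
    (hS : HH μ S = HS) :
    τ ≤ 2 * HAS + 2 * HBS - 3 * HS - 3 * Q + 2 * HC
      + η * ((Ent (cv r (mm μ A)) - Ent r / 2 - (Q - HC) / 2) +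
        (Ent (cv r (mm μ B)) - Ent r / 2 - (Q - HC) / 2)) := by
  set C : Ω → G × G := fun ω => (A ω + B ω, S ω) with hCdef
  have hν := dbl_pr h C
  have hsum : ∀ w : Ω × Ω, (dbl μ C) w ≠ 0 → A w.1 + B w.1 = A w.2 + B w.2 ∧ S w.1 = S w.2 := by
    intro w hw
    have := dbl_ne hw
    simpa [C] using this
  have m := master hr hη hτ hν (dbl_ci h C A B)
  have qC : HH (dbl μ C) (fun w => C w.1) = HC := by rw [dbl_HH_fst h, hC]
  have qS : HH (dbl μ C) (fun w => S w.1) = HS := by rw [dbl_HH_fst h, hS]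
  have qAC : HH (dbl μ C) (fun w => (A w.1, C w.1)) = Q := by
    rw [dbl_HH_fst h C (fun ω => (A ω, C ω)), ← hQ]
    exact HH_congr fun ω ω' _ _ => by simp only [C, Prod.mk.injEq]; grind
  have qBC : HH (dbl μ C) (fun w => (B w.2, C w.1)) = Q := by
    rw [HH_congr (Y := fun w : Ω × Ω => (B w.2, C w.2))
      (fun w w' hw hw' => by rw [dbl_ne hw, dbl_ne hw']), dbl_HH_snd h C (fun ω => (B ω, C ω)), ← hQ]
    exact HH_congr fun ω ω' _ _ => by simp only [C, Prod.mk.injEq]; grind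
  have s1 := submod hν (fun w : Ω × Ω => A w.1) (fun w => B w.1) (fun w => (A w.1 + B w.2, S w.1))
  have s2 := submod hν (fun w : Ω × Ω => A w.1) (fun w => B w.2) (fun w => S w.1)
  have s3 := submod hν (fun w : Ω × Ω => B w.1) (fun w => A w.2) (fun w => S w.1)
  have s4 := submod hν (fun w : Ω × Ω => A w.1 + B w.2) (fun w => A w.1 + B w.1) (fun w => S w.1)
  have c1 := (dbl_ci h C (fun ω => (A ω, B ω)) (fun ω => (A ω, B ω))).HH hν
  have e1 : HH (dbl μ C) (fun w => ((A w.1, B w.1), C w.1)) = Q := by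
    rw [dbl_HH_fst h C (fun ω => ((A ω, B ω), C ω)), ← hQ]
    exact HH_congr fun ω ω' _ _ => by simp only [C, Prod.mk.injEq]; grind
  have e2 : HH (dbl μ C) (fun w => ((A w.2, B w.2), C w.1)) = Q := by
    rw [HH_congr (Y := fun w : Ω × Ω => ((A w.2, B w.2), C w.2))
      (fun w w' hw hw' => by rw [dbl_ne hw, dbl_ne hw']),
      dbl_HH_snd h C (fun ω => ((A ω, B ω), C ω)), ← hQ]
    exact HH_congr fun ω ω' _ _ => by simp only [C, Prod.mk.injEq]; grind
  have e3 : HH (dbl μ C) (fun w => (A w.1, B w.1, (A w.1 + B w.2, S w.1))) =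
      HH (dbl μ C) (fun w => ((A w.1, B w.1), (A w.2, B w.2), C w.1)) :=
    HH_congr fun w w' hw hw' => by
      have := hsum w hw
      have := hsum w' hw'
      simp only [C, Prod.mk.injEq]; grind
  have e4 : HH (dbl μ C) (fun w => (A w.1, (A w.1 + B w.2, S w.1))) =
      HH (dbl μ C) (fun w => (A w.1, B w.2, S w.1)) :=
    HH_congr fun w w' hw hw' => by
      simp only [Prod.mk.injEq]; grind
  have e5 : HH (dbl μ C) (fun w => (B w.1, (A w.1 + B w.2, S w.1))) =
      HH (dbl μ C) (fun w => (B w.1, A w.2, S w.1)) :=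
    HH_congr fun w w' hw hw' => by
      have a1 := (hsum w hw).1
      have a2 := (hsum w' hw').1
      have b1 : A w.1 + B w.2 = A w.2 + B w.1 := by
        linear_combination a1 + (B w.2 - B w.1) * h2
      have b2 : A w'.1 + B w'.2 = A w'.2 + B w'.1 := by
        linear_combination a2 + (B w'.2 - B w'.1) * h2
      simp only [Prod.mk.injEq, b1, b2]; grind
  have e6 : HH (dbl μ C) (fun w => (A w.1, S w.1)) = HAS := by
    rw [dbl_HH_fst h C (fun ω => (A ω, S ω)), hAS]
  have e7 : HH (dbl μ C) (fun w => (B w.1, S w.1)) = HBS := by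
    rw [dbl_HH_fst h C (fun ω => (B ω, S ω)), hBS]
  have e8 : HH (dbl μ C) (fun w => (B w.2, S w.1)) = HBS := by
    rw [HH_congr (Y := fun w : Ω × Ω => (B w.2, S w.2))
      (fun w w' hw hw' => by rw [(hsum w hw).2, (hsum w' hw').2]),
      dbl_HH_snd h C (fun ω => (B ω, S ω)), hBS]
  have e9 : HH (dbl μ C) (fun w => (A w.2, S w.1)) = HAS := by
    rw [HH_congr (Y := fun w : Ω × Ω => (A w.2, S w.2))
      (fun w w' hw hw' => by rw [(hsum w hw).2, (hsum w' hw').2]),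
      dbl_HH_snd h C (fun ω => (A ω, S ω)), hAS]
  have e10 : HH (dbl μ C) (fun w => (A w.1 + B w.1, S w.1)) = HC := by
    rw [← qC]
  have e11 : HH (dbl μ C) (fun w => (A w.1 + B w.2, C w.1)) =
      HH (dbl μ C) (fun w => (A w.1 + B w.2, A w.1 + B w.1, S w.1)) := rfl
  rw [qC, qAC, qBC, dbl_mm_fst h, dbl_mm_snd h, e11] at m
  rw [e3, e4, e5] at s1
  rw [e6, e8, qS] at s2
  rw [e7, e9, qS] at s3
  rw [e10, qS] at s4
  rw [e1, e2, qC] at c1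
  linarith

/-- Four independent variables with prescribed laws. -/
def P4 (μ : Ω → ℝ) (X Y Z W : Ω → G) (f g k l : G → ℝ) : Prop :=
  ∀ a b c d, mm μ (fun ω => (X ω, Y ω, Z ω, W ω)) (a, b, c, d) = f a * g b * k c * l d

lemma P4.swap12 {μ : Ω → ℝ} {X Y Z W : Ω → G} {f g k l : G → ℝ} (h : P4 μ X Y Z W f g k l) :
    P4 μ Y X Z W g f k l := by
  intro a b c d
  rw [mul_comm (g a), ← h b a c d]
  exact mm_iff fun ω => by simp only [Prod.mk.injEq]; tauto

lemma P4.rot {μ : Ω → ℝ} {X Y Z W : Ω → G} {f g k l : G → ℝ} (h : P4 μ X Y Z W f g k l) :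
    P4 μ Y Z W X g k l f := by
  intro a b c d
  have : g a * k b * l c * f d = f d * g a * k b * l c := by ring
  rw [this, ← h d a b c]
  exact mm_iff fun ω => by simp only [Prod.mk.injEq]; tauto

lemma P4.pair {μ : Ω → ℝ} {X Y Z W : Ω → G} {f g k l : G → ℝ} (h : P4 μ X Y Z W f g k l)
    (hk : IsPr k) (hl : IsPr l) (a b : G) :
    mm μ (fun ω => (X ω, Y ω)) (a, b) = f a * g b := by
  rw [← mm_marg μ (fun ω => (X ω, Y ω)) (fun ω => (Z ω, W ω)), Fintype.sum_prod_type]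
  have : ∀ c d, mm μ (fun ω => ((X ω, Y ω), (Z ω, W ω))) ((a, b), (c, d)) =
      f a * g b * (k c * l d) := by
    intro c d
    rw [← mul_assoc, ← h a b c d]
    exact mm_iff fun ω => by simp only [Prod.mk.injEq]; tauto
  simp only [this, ← Finset.mul_sum, hl.2, mul_one, hk.2]

lemma P4.law {μ : Ω → ℝ} {X Y Z W : Ω → G} {f g k l : G → ℝ} (h : P4 μ X Y Z W f g k l)
    (hg : IsPr g) (hk : IsPr k) (hl : IsPr l) : mm μ X = f := by
  funext a
  rw [← mm_marg μ X Y]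
  simp only [h.pair hk hl, ← Finset.mul_sum, hg.2, mul_one]

lemma P4.ind {μ : Ω → ℝ} {X Y Z W : Ω → G} {f g k l : G → ℝ} (h : P4 μ X Y Z W f g k l)
    (hf : IsPr f) (hg : IsPr g) (hk : IsPr k) (hl : IsPr l) : Ind μ X Y := by
  intro a b
  rw [h.pair hk hl, h.law hg hk hl, h.swap12.law hf hk hl]

lemma P4.ind2 {μ : Ω → ℝ} {X Y Z W : Ω → G} {f g k l : G → ℝ} (h : P4 μ X Y Z W f g k l)
    (hf : IsPr f) (hg : IsPr g) (hk : IsPr k) (hl : IsPr l) :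
    Ind μ (fun ω => (X ω, Y ω)) (fun ω => (Z ω, W ω)) := by
  rintro ⟨a, b⟩ ⟨c, d⟩
  rw [h.pair hk hl, h.rot.rot.pair hf hg, ← mul_assoc, ← h a b c d]
  exact mm_iff fun ω => by simp only [Prod.mk.injEq]; tauto

lemma exists_P4 {f g k l : G → ℝ} (hf : IsPr f) (hg : IsPr g) (hk : IsPr k) (hl : IsPr l) :
    ∃ (μ : G × G × G × G → ℝ) (X Y Z W : G × G × G × G → G), IsPr μ ∧ P4 μ X Y Z W f g k l := by
  refine ⟨fun s => f s.1 * g s.2.1 * k s.2.2.1 * l s.2.2.2, fun s => s.1, fun s => s.2.1,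
    fun s => s.2.2.1, fun s => s.2.2.2, ⟨?_, ?_⟩, ?_⟩
  · intro s
    exact mul_nonneg (mul_nonneg (mul_nonneg (hf.1 _) (hg.1 _)) (hk.1 _)) (hl.1 _)
  · simp only [Fintype.sum_prod_type, ← Finset.mul_sum, hl.2, hk.2, hg.2, hf.2, mul_one]
  · intro a b c d
    simp [mm]

lemma cv_comm (p q : G → ℝ) : cv p q = cv q p := by
  funext s
  rw [cv, ← (Equiv.subLeft s).sum_comp]
  simp [cv, mul_comm]

lemma kv {r p q : G → ℝ} (hr : IsPr r) (hp : IsPr p) (hq : IsPr q) :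
    Ent (cv r (cv p q)) - Ent (cv r p) ≤ Ent (cv p q) - Ent p := by
  obtain ⟨μ, R, Y, Z, W, h, h4⟩ := exists_P4 hr hp hq hq
  have i0 := h4.ind2 hr hp hq hq
  have i1 : Ind μ R (fun ω => Y ω + Z ω) :=
    (h4.rot.rot.rot.ind2 hq hr hp hq).comp (fun s => s.2) (fun s => s.1 + s.2)
  have i2 : Ind μ (fun ω => R ω + Y ω) Z := i0.comp (fun s => s.1 + s.2) (fun s => s.1)
  have i3 : Ind μ (fun ω => (R ω, Y ω)) Z := i0.comp (fun s => s) (fun s => s.1)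
  have i4 := h4.ind hr hp hq hq
  have i5 := h4.rot.ind hp hq hq hr
  have s1 := submod h R Z (fun ω => R ω + (Y ω + Z ω))
  have e1 : HH μ (fun ω => (R ω, Z ω, R ω + (Y ω + Z ω))) = HH μ (fun ω => ((R ω, Y ω), Z ω)) :=
    HH_congr fun _ _ _ _ => by simp only [Prod.mk.injEq]; grind
  have e2 : HH μ (fun ω => (R ω, R ω + (Y ω + Z ω))) = HH μ (fun ω => (R ω, Y ω + Z ω)) :=
    HH_congr fun _ _ _ _ => by simp only [Prod.mk.injEq]; grind
  have e3 : HH μ (fun ω => (Z ω, R ω + (Y ω + Z ω))) = HH μ (fun ω => (R ω + Y ω, Z ω)) :=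
    HH_congr fun _ _ _ _ => by simp only [Prod.mk.injEq]; grind
  rw [e1, e2, e3, i1.HH h, i2.HH h, i3.HH h, i4.HH h, HH_eq _ (fun ω => R ω + (Y ω + Z ω)),
    i1.cv, HH_eq _ (fun ω => Y ω + Z ω), i5.cv, HH_eq _ (fun ω => R ω + Y ω), i4.cv, HH_eq _ Y,
    h4.law hp hq hq, h4.rot.law hq hq hr, h4.rot.rot.law hq hr hp] at s1
  linarith

lemma ent_le_cv {p q : G → ℝ} (hp : IsPr p) (hq : IsPr q) :
    Ent p ≤ Ent (cv p q) ∧ Ent q ≤ Ent (cv p q) := by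
  obtain ⟨μ, X, Y, Z, W, h, h4⟩ := exists_P4 hp hq hp hq
  have i := h4.ind hp hq hp hq
  have l1 := h4.law hq hp hq
  have l2 := h4.swap12.law hp hp hq
  have s1 := subadd h (fun ω => X ω + Y ω) Y
  have s2 := subadd h (fun ω => X ω + Y ω) X
  rw [HH_congr (Y := fun ω => (X ω, Y ω)) (fun _ _ _ _ => by simp only [Prod.mk.injEq]; grind),
    i.HH h, HH_eq _ X, HH_eq _ Y, HH_eq _ (fun ω => X ω + Y ω), i.cv, l1, l2] at s1 s2
  constructor <;> linarith

theorem main_ent (h2 : (2 : G) = 0) {r p q : G → ℝ} (hr : IsPr r) (hp : IsPr p) (hq : IsPr q)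
    (hτ : ∀ p' q', IsPr p' → IsPr q' → tau r (1 / 9) p q ≤ tau r (1 / 9) p' q') :
    Ent (cv p q) = Ent p / 2 + Ent q / 2 ∧ Ent (cv p p) = Ent p ∧ Ent (cv q q) = Ent q := by
  obtain ⟨μ, X, X', Y, Y', h, h4⟩ := exists_P4 hp hp hq hq
  have o1 : P4 μ X Y' X' Y p q p q := h4.rot.rot.rot.swap12
  have o3 : P4 μ X Y X' Y' p q p q := h4.swap12.rot.rot.rot.swap12.rot.rot
  have I1 := o1.ind2 hp hq hp hq
  have I2 := h4.ind2 hp hp hq hq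
  have I3 := o3.ind2 hp hq hp hq
  have lX : mm μ X = p := h4.law hp hq hq
  have lX' : mm μ X' = p := h4.rot.law hq hq hp
  have lY : mm μ Y = q := h4.rot.rot.law hq hp hp
  have lY' : mm μ Y' = q := h4.rot.rot.rot.law hp hp hq
  have iXY := o3.ind hp hq hp hq
  have iXY' := o1.ind hp hq hp hq
  have iX'Y := o1.rot.rot.ind hp hq hp hq
  have iX'Y' := o3.rot.rot.ind hp hq hp hq
  have iXX := h4.ind hp hp hq hq
  have iYY := h4.rot.rot.ind hq hq hp hp
  have lXY : mm μ (fun ω => X ω + Y ω) = cv p q := by rw [iXY.cv, lX, lY]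
  have lXY' : mm μ (fun ω => X ω + Y' ω) = cv p q := by rw [iXY'.cv, lX, lY']
  have lX'Y : mm μ (fun ω => X' ω + Y ω) = cv p q := by rw [iX'Y.cv, lX', lY]
  have lX'Y' : mm μ (fun ω => X' ω + Y' ω) = cv p q := by rw [iX'Y'.cv, lX', lY']
  have lXX : mm μ (fun ω => X ω + X' ω) = cv p p := by rw [iXX.cv, lX, lX']
  have lYY : mm μ (fun ω => Y ω + Y' ω) = cv q q := by rw [iYY.cv, lY, lY']
  set σ := HH μ (fun ω => (X ω + Y' ω) + (X' ω + Y ω)) with hσ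
  set Q := HH μ (fun ω => (X ω + Y ω, X' ω + Y ω, (X ω + Y' ω) + (X' ω + Y ω))) with hQ
  -- (a)
  have a := master0 hτ h (I1.comp (fun s => s.1 + s.2) (fun s => s.1 + s.2))
  dsimp only at a
  rw [← hσ, HH_eq _ (fun ω => X ω + Y' ω), HH_eq _ (fun ω => X' ω + Y ω), lXY', lX'Y] at a
  -- (b)
  have b := master hr (by norm_num) hτ h
    (I1.ci (fun s => s.1) (fun s => s.2) (fun s => s.1 + s.2) (fun s => s.1 + s.2))
  dsimp only at b
  have b1 : HH μ (fun ω => (X ω + Y ω, X ω + Y' ω, X' ω + Y ω)) = Q :=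
    HH_congr fun _ _ _ _ => by simp only [Prod.mk.injEq]; grind
  have b2 : HH μ (fun ω => (X ω + Y' ω, X' ω + Y ω)) = 2 * Ent (cv p q) := by
    rw [(I1.comp (fun s => s.1 + s.2) (fun s => s.1 + s.2)).HH h, HH_eq, HH_eq, lXY', lX'Y]; ring
  have b3 : HH μ (fun ω => (X ω, X ω + Y' ω, X' ω + Y ω)) = Ent p + Ent q + Ent (cv p q) := by
    rw [HH_congr (Y := fun ω => ((X ω, Y' ω), X' ω + Y ω))
      (fun _ _ _ _ => by simp only [Prod.mk.injEq]; grind),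
      (I1.comp (fun s => s) (fun s => s.1 + s.2)).HH h, iXY'.HH h, HH_eq, HH_eq, HH_eq,
      lX, lY', lX'Y]
  have b4 : HH μ (fun ω => (Y ω, X ω + Y' ω, X' ω + Y ω)) = Ent (cv p q) + (Ent p + Ent q) := by
    rw [HH_congr (Y := fun ω => (X ω + Y' ω, (X' ω, Y ω)))
      (fun _ _ _ _ => by simp only [Prod.mk.injEq]; grind),
      (I1.comp (fun s => s.1 + s.2) (fun s => s)).HH h, iX'Y.HH h, HH_eq, HH_eq, HH_eq,
      lX', lY, lXY']
  rw [b1, b2, b3, b4, lX, lY] at b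
  -- (c)
  have c := master0 hτ h (I2.comp (fun s => s.1 + s.2) (fun s => s.1 + s.2))
  dsimp only at c
  have c1 : HH μ (fun ω => X ω + X' ω + (Y ω + Y' ω)) = σ := by
    rw [hσ]; congr 1; funext ω; ring
  rw [c1, HH_eq _ (fun ω => X ω + X' ω), HH_eq _ (fun ω => Y ω + Y' ω), lXX, lYY] at c
  -- (d)
  have d := master hr (by norm_num) hτ h
    (I2.ci (fun s => s.1) (fun s => s.1) (fun s => s.1 + s.2) (fun s => s.1 + s.2))
  dsimp only at d
  have d1 : HH μ (fun ω => (X ω + Y ω, X ω + X' ω, Y ω + Y' ω)) = Q :=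
    HH_congr fun ω ω' _ _ => by
      simp only [Prod.mk.injEq]
      constructor
      · rintro ⟨u, v, w⟩
        refine ⟨u, ?_, ?_⟩
        · linear_combination v - u + (Y ω - Y ω') * h2
        · linear_combination v + w
      · rintro ⟨u, v, w⟩
        refine ⟨u, ?_, ?_⟩
        · linear_combination u + v + (Y ω' - Y ω) * h2
        · linear_combination w - u - v + (Y ω - Y ω') * h2
  have d2 : HH μ (fun ω => (X ω + X' ω, Y ω + Y' ω)) = Ent (cv p p) + Ent (cv q q) := by
    rw [(I2.comp (fun s => s.1 + s.2) (fun s => s.1 + s.2)).HH h, HH_eq, HH_eq, lXX, lYY]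
  have d3 : HH μ (fun ω => (X ω, X ω + X' ω, Y ω + Y' ω)) = Ent p + Ent p + Ent (cv q q) := by
    rw [HH_congr (Y := fun ω => ((X ω, X' ω), Y ω + Y' ω))
      (fun _ _ _ _ => by simp only [Prod.mk.injEq]; grind),
      (I2.comp (fun s => s) (fun s => s.1 + s.2)).HH h, iXX.HH h, HH_eq, HH_eq, HH_eq,
      lX, lX', lYY]
  have d4 : HH μ (fun ω => (Y ω, X ω + X' ω, Y ω + Y' ω)) = Ent (cv p p) + (Ent q + Ent q) := by
    rw [HH_congr (Y := fun ω => (X ω + X' ω, (Y ω, Y' ω)))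
      (fun _ _ _ _ => by simp only [Prod.mk.injEq]; grind),
      (I2.comp (fun s => s.1 + s.2) (fun s => s)).HH h, iYY.HH h, HH_eq, HH_eq, HH_eq,
      lY, lY', lXX]
  rw [d1, d2, d3, d4, lX, lY] at d
  -- (e)
  have e1 : HH μ (fun ω => (X ω + Y ω + (X' ω + Y ω), (X ω + Y' ω) + (X' ω + Y ω))) =
      Ent (cv p p) + Ent (cv q q) := by
    rw [← d2]
    exact HH_congr fun ω ω' _ _ => by
      simp only [Prod.mk.injEq]
      constructor
      · rintro ⟨u, v⟩
        constructor
        · linear_combination u - (Y ω - Y ω') * h2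
        · linear_combination v - u + (Y ω - Y ω') * h2
      · rintro ⟨u, v⟩
        constructor
        · linear_combination u + (Y ω - Y ω') * h2
        · linear_combination u + v
  have e2 : HH μ (fun ω => (X ω + Y ω, (X ω + Y' ω) + (X' ω + Y ω))) = 2 * Ent (cv p q) := by
    rw [HH_congr (Y := fun ω => (X ω + Y ω, X' ω + Y' ω))
      (fun _ _ _ _ => by simp only [Prod.mk.injEq]; grind),
      (I3.comp (fun s => s.1 + s.2) (fun s => s.1 + s.2)).HH h, HH_eq, HH_eq, lXY, lX'Y']; ring
  have e3 : HH μ (fun ω => (X' ω + Y ω, (X ω + Y' ω) + (X' ω + Y ω))) = 2 * Ent (cv p q) := by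
    rw [← b2]
    exact HH_congr fun _ _ _ _ => by simp only [Prod.mk.injEq]; grind
  have e := bsg h2 hr (by norm_num) hτ h (fun ω => X ω + Y ω) (fun ω => X' ω + Y ω)
    (fun ω => (X ω + Y' ω) + (X' ω + Y ω)) hQ.symm e1 e2 e3 hσ.symm
  rw [lXY, lX'Y] at e
  have s := submod h (fun ω => X ω + Y ω) (fun ω => X' ω + Y ω)
    (fun ω => (X ω + Y' ω) + (X' ω + Y ω))
  rw [e2, e3, ← hσ, ← hQ] at s
  have k1 := kv hr hp hq
  have k2 := kv hr hq hp
  rw [cv_comm q p] at k2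
  have k3 := kv hr hp hp
  have k4 := kv hr hq hq
  obtain ⟨n1, n2⟩ := ent_le_cv hp hq
  obtain ⟨n3, -⟩ := ent_le_cv hp hp
  obtain ⟨n4, -⟩ := ent_le_cv hq hq
  simp only [tau] at a b c d e
  clear_value σ Q
  have hk : Ent (cv p q) ≤ Ent p / 2 + Ent q / 2 := by linarith
  refine ⟨by linarith, by linarith, by linarith⟩

lemma cont_Ent {f : (G → ℝ) × (G → ℝ) → G → ℝ} (hf : ∀ s, Continuous fun x => f x s) :
    Continuous fun x => Ent (f x) := by
  refine continuous_finsetSum _ fun s _ => ?_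
  exact continuous_negMulLog.comp (hf s)

lemma cont_cv {f g : (G → ℝ) × (G → ℝ) → G → ℝ} (hf : ∀ s, Continuous fun x => f x s)
    (hg : ∀ s, Continuous fun x => g x s) (s : G) :
    Continuous fun x => cv (f x) (g x) s :=
  continuous_finsetSum _ fun y _ => (hf y).mul (hg (s - y))

lemma exists_min {r : G → ℝ} (hr : IsPr r) (η : ℝ) :
    ∃ p q, IsPr p ∧ IsPr q ∧ ∀ p' q', IsPr p' → IsPr q' → tau r η p q ≤ tau r η p' q' := by
  have hc : IsCompact (stdSimplex ℝ G ×ˢ stdSimplex ℝ G) :=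
    (isCompact_stdSimplex ℝ G).prod (isCompact_stdSimplex ℝ G)
  have c1 : ∀ s : G, Continuous fun x : (G → ℝ) × (G → ℝ) => x.1 s :=
    fun s => (continuous_apply s).comp continuous_fst
  have c2 : ∀ s : G, Continuous fun x : (G → ℝ) × (G → ℝ) => x.2 s :=
    fun s => (continuous_apply s).comp continuous_snd
  have c3 : ∀ s : G, Continuous fun x : (G → ℝ) × (G → ℝ) => r s :=
    fun s => continuous_const
  have e1 := cont_Ent c1
  have e2 := cont_Ent c2
  have e3 := cont_Ent (cont_cv c1 c2)
  have e4 := cont_Ent (cont_cv c3 c1)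
  have e5 := cont_Ent (cont_cv c3 c2)
  have hcont : Continuous (fun x : (G → ℝ) × (G → ℝ) => tau r η x.1 x.2) := by
    unfold tau
    fun_prop
  obtain ⟨x, hpq, hmin⟩ := hc.exists_isMinOn ⟨(r, r), Set.mk_mem_prod hr hr⟩ hcont.continuousOn
  refine ⟨x.1, x.2, hpq.1, hpq.2, fun p' q' hp' hq' => ?_⟩
  exact isMinOn_iff.1 hmin (p', q') (Set.mk_mem_prod hp' hq')

/-- Uniform distribution. -/
def un (B : Finset G) (x : G) : ℝ := if x ∈ B then 1 / (B.card : ℝ) else 0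

lemma isPr_un {B : Finset G} (hB : B.Nonempty) : IsPr (un B) := by
  have : (B.card : ℝ) ≠ 0 := by simpa using hB.ne_empty
  refine ⟨fun x => ?_, ?_⟩
  · rw [un]; split_ifs <;> positivity
  · simp [un, this]

lemma ent_un {B : Finset G} (hB : B.Nonempty) : Ent (un B) = log B.card := by
  have : (B.card : ℝ) ≠ 0 := by simpa using hB.ne_empty
  have e : ∀ x, negMulLog (un B x) = if x ∈ B then negMulLog (1 / (B.card : ℝ)) else 0 := by
    intro x; rw [un]; split_ifs <;> simp
  simp only [Ent, e, Finset.sum_ite_mem, Finset.univ_inter, Finset.sum_const, nsmul_eq_mul]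
  simp [negMulLog]; field_simp

lemma ent_le_log {p : G → ℝ} (hp : IsPr p) {B : Finset G} (hB : B.Nonempty)
    (h : ∀ x, x ∉ B → p x = 0) : Ent p ≤ log B.card := by
  have h0 : (0 : ℝ) < B.card := by exact_mod_cast hB.card_pos
  have h1 : Ent p = ∑ x ∈ B, negMulLog (p x) := by
    rw [Ent]; symm
    exact Finset.sum_subset (Finset.subset_univ B) fun x _ hx => by rw [h x hx]; simp
  have h2 : ∑ x ∈ B, p x = 1 := by
    rw [← hp.2]
    exact Finset.sum_subset (Finset.subset_univ B) fun x _ hx => h x hx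
  have := concaveOn_negMulLog.le_map_sum (t := B) (w := fun _ => 1 / (B.card : ℝ))
    (p := p) (fun c _ => by positivity) (by simp [h0.ne']) (fun c _ => hp.1 c)
  simp only [smul_eq_mul, ← Finset.mul_sum, h2, ← h1] at this
  simp only [negMulLog, mul_one] at this
  rw [one_div, log_inv] at this
  have := mul_le_mul_of_nonneg_left this h0.le
  field_simp at this
  linarith

lemma ent_exists {p : G → ℝ} (hp : IsPr p) : ∃ x, 0 < p x ∧ - log (p x) ≤ Ent p := by
  by_contra! hcon
  have h1 : ∑ x, p x * (- log (p x) - Ent p) = 0 := by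
    simp only [mul_sub, Finset.sum_sub_distrib, ← Finset.sum_mul, hp.2]
    simp [Ent, negMulLog]
  have h2 : ∀ x ∈ Finset.univ, 0 ≤ p x * (- log (p x) - Ent p) := by
    intro x _
    rcases (hp.1 x).eq_or_lt with h | h
    · simp [← h]
    · have := hcon x h
      exact mul_nonneg h.le (by linarith)
  rw [Finset.sum_eq_zero_iff_of_nonneg h2] at h1
  have h3 : ∀ x, p x = 0 := by
    intro x
    by_contra hx
    have hx' := lt_of_le_of_ne (hp.1 x) (Ne.symm hx)
    have a1 := hcon x hx'
    have a2 := h1 x (Finset.mem_univ x)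
    rcases mul_eq_zero.1 a2 with h | h
    · exact hx h
    · linarith
  have := hp.2
  simp [h3] at this

lemma coset_of_ent {p : G → ℝ} (hp : IsPr p) (he : Ent (cv p p) = Ent p) :
    ∃ (H : AddSubgroup G) (x0 : G), p = un (Finset.univ.filter fun x => x - x0 ∈ H) := by
  have J : ∀ s, ∑ y, p y * negMulLog (p (s - y)) ≤ negMulLog (∑ y, p y * p (s - y)) := fun s => by
    have := concaveOn_negMulLog.le_map_sum (t := Finset.univ) (w := p)
      (p := fun y => p (s - y)) (fun c _ => hp.1 c) hp.2 (fun c _ => hp.1 _)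
    simpa using this
  have hs : ∑ s, ∑ y, p y * negMulLog (p (s - y)) = Ent p := by
    rw [Finset.sum_comm]
    have : ∀ y, ∑ s, negMulLog (p (s - y)) = Ent p := fun y => by
      have := (Equiv.subRight y).sum_comp (fun x => negMulLog (p x))
      simpa [Ent] using this
    simp only [← Finset.mul_sum, this, ← Finset.sum_mul, hp.2, one_mul]
  have hE : ∀ s, ∑ y, p y * negMulLog (p (s - y)) = negMulLog (∑ y, p y * p (s - y)) := by
    have := (Finset.sum_eq_sum_iff_of_le (s := Finset.univ) fun s _ => J s).1
      (by rw [hs, ← he]; rfl)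
    exact fun s => this s (Finset.mem_univ s)
  have key : ∀ y y' s, p y ≠ 0 → p y' ≠ 0 → p (s - y) = p (s - y') := by
    intro y y' s hy hy'
    have := (strictConcaveOn_negMulLog.map_sum_eq_iff_of_nonneg (t := Finset.univ) (w := p)
      (p := fun y => p (s - y)) (fun c _ => hp.1 c) hp.2 (fun c _ => hp.1 _)).1
      (by simpa using (hE s).symm)
    exact this (Finset.mem_univ y) hy (Finset.mem_univ y') hy'
  obtain ⟨x0, hx0, -⟩ := ent_exists hp
  let H : AddSubgroup G :=
    { carrier := {h | ∀ x, p (x + h) = p x}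
      zero_mem' := by simp
      add_mem' := by
        intro a b ha hb x
        rw [← add_assoc, hb, ha]
      neg_mem' := by
        intro a ha x
        have := ha (x + -a)
        rw [neg_add_cancel_right] at this
        exact this.symm }
  have hH : ∀ h, h ∈ H ↔ ∀ x, p (x + h) = p x := fun h => Iff.rfl
  have h1 : ∀ x, x - x0 ∈ H ↔ p x ≠ 0 := by
    intro x
    constructor
    · intro h
      have := (hH _).1 h x0
      rw [add_sub_cancel] at this
      rw [this]; exact hx0.ne'
    · intro h
      rw [hH]
      intro z
      have := key x x0 (z + x) h hx0.ne'
      rw [add_sub_cancel_right] at this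
      rw [this]; congr 1; ring
  have h2 : ∀ x, x - x0 ∈ H → p x = p x0 := by
    intro x h
    have := (hH _).1 h x0
    rwa [add_sub_cancel] at this
  refine ⟨H, x0, ?_⟩
  set B := Finset.univ.filter fun x => x - x0 ∈ H with hB
  have h3 : ∀ x, p x = if x ∈ B then p x0 else 0 := by
    intro x
    by_cases hx : x - x0 ∈ H
    · simp [hB, hx, h2 x hx]
    · have := (h1 x).not.1 hx
      simp only [ne_eq, not_not] at this
      simp [hB, hx, this]
  have h4 : (B.card : ℝ) * p x0 = 1 := by
    rw [← hp.2, Finset.sum_congr rfl fun x _ => h3 x]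
    simp
  funext x
  rw [h3 x, un]
  have : p x0 = 1 / (B.card : ℝ) := eq_one_div_of_mul_eq_one_right h4
  rw [this]

lemma card_coset (H : AddSubgroup G) (x0 : G) :
    (Finset.univ.filter fun x => x - x0 ∈ H).card = Nat.card H := by
  rw [Nat.card_eq_fintype_card, ← Fintype.card_subtype]
  exact Fintype.card_congr ((Equiv.subRight x0).subtypeEquiv fun a => by simp)

theorem ent_pfr (h2 : (2 : G) = 0) {A AA : Finset G} (hA : A.Nonempty)
    (hAA : ∀ x ∈ A, ∀ y ∈ A, x + y ∈ AA) {K : ℝ} (hK : 1 ≤ K)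
    (hadd : (AA.card : ℝ) ≤ K * A.card) :
    ∃ (H : AddSubgroup G) (B : Finset G), B ⊆ A ∧ B.Nonempty ∧
      (∀ x ∈ B, ∀ y ∈ B, x - y ∈ H) ∧
      log A.card / 2 + log (Nat.card H) / 2 ≤ log B.card + 11 / 2 * log K ∧
      log A.card ≤ log (Nat.card H) + 11 * log K ∧
      log (Nat.card H) ≤ log A.card + 11 * log K := by
  set r := un A with hrdef
  have hr : IsPr r := isPr_un hA
  have hAc : (0 : ℝ) < A.card := by exact_mod_cast hA.card_pos
  obtain ⟨p, q, hp, hq, hmin⟩ := exists_min hr (1 / 9)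
  obtain ⟨m1, m2, m3⟩ := main_ent h2 hr hp hq hmin
  have mr := hmin r r hr hr
  have er : Ent r = log A.card := ent_un hA
  have hAAne : AA.Nonempty := by
    obtain ⟨x, hx⟩ := hA
    exact ⟨_, hAA x hx x hx⟩
  have err : Ent (cv r r) ≤ log K + log A.card := by
    rw [← log_mul (by linarith) hAc.ne']
    refine (ent_le_log (isPr_cv hr hr) hAAne ?_).trans
      (log_le_log (by exact_mod_cast hAAne.card_pos) hadd)
    intro x hx
    refine Finset.sum_eq_zero fun y _ => ?_
    by_cases hy : y ∈ A
    · by_cases hxy : x - y ∈ A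
      · have := hAA _ hy _ hxy
        rw [add_sub_cancel] at this
        exact absurd this hx
      · simp [hrdef, un, hxy]
    · simp [hrdef, un, hy]
  simp only [tau] at mr
  have : ∃ t, IsPr t ∧ Ent (cv t t) = Ent t ∧
      Ent (cv r t) - Ent r / 2 - Ent t / 2 ≤ 11 / 2 * log K := by
    by_cases hle : Ent (cv r p) - Ent r / 2 - Ent p / 2 ≤ 11 / 2 * log K
    · exact ⟨p, hp, m2, hle⟩
    · exact ⟨q, hq, m3, by linarith⟩
  obtain ⟨t, ht, htt, hd⟩ := this
  obtain ⟨H, x0, rfl⟩ := coset_of_ent ht htt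
  set D := Finset.univ.filter fun x => x - x0 ∈ H with hD
  have hDne : D.Nonempty := ⟨x0, by simp [hD, H.zero_mem]⟩
  have hDc : (0 : ℝ) < D.card := by exact_mod_cast hDne.card_pos
  have eD : D.card = Nat.card H := card_coset H x0
  rw [er, ent_un hDne] at hd
  obtain ⟨n1, n2⟩ := ent_le_cv hr ht
  rw [er] at n1
  rw [ent_un hDne] at n2
  obtain ⟨x, hx, hx'⟩ := ent_exists (isPr_cv hr ht)
  have hcv : cv r (un D) x =
      ((A.filter fun y => x - y ∈ D).card : ℝ) * (1 / (A.card : ℝ) * (1 / (D.card : ℝ))) := by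
    have : ∀ y, r y * un D (x - y) = if y ∈ A.filter (fun y => x - y ∈ D) then
        1 / (A.card : ℝ) * (1 / (D.card : ℝ)) else 0 := by
      intro y
      by_cases a1 : y ∈ A <;> by_cases a2 : x - y ∈ D <;> simp [hrdef, un, a1, a2]
    simp only [cv, this, Finset.sum_ite_mem, Finset.univ_inter, Finset.sum_const, nsmul_eq_mul]
  set B := A.filter fun y => x - y ∈ D with hB
  rw [hcv] at hx hx'
  have hBc : (0 : ℝ) < B.card := by
    by_contra hcon
    have : (B.card : ℝ) = 0 := le_antisymm (not_lt.1 hcon) (Nat.cast_nonneg _)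
    simp [this] at hx
  rw [log_mul hBc.ne' (by positivity), log_mul (by positivity) (by positivity), one_div, one_div,
    log_inv, log_inv] at hx'
  refine ⟨H, B, Finset.filter_subset _ _, ?_, ?_, by rw [← eD]; linarith,
    by rw [← eD]; linarith, by rw [← eD]; linarith⟩
  · rw [← Finset.card_pos]; exact_mod_cast hBc
  · intro a ha b hb
    simp only [hB, hD, Finset.mem_filter, Finset.mem_univ, true_and] at ha hb
    have := H.sub_mem hb.2 ha.2
    have e : a - b = (x - b - x0) - (x - a - x0) := by ring
    rw [e]; exact this

end PFR

/-- **Marton's conjecture / Polynomial Freiman–Ruzsa over F_2, with exponent 12.**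
If `A` is a non-empty finite subset of `F_2^n` with `|A + A| ≤ K|A|`, then there is a
subgroup `H` of `F_2^n` with `|H| ≤ |A|` such that `A` is covered by at most `2 K^12`
cosets of `H`. -/
theorem pfr {n : ℕ} (A : Finset (Fin n → ZMod 2)) (hA : A.Nonempty) (K : ℝ) (hK : 1 ≤ K)
    (hadd : ((A + A).card : ℝ) ≤ K * A.card) :
    ∃ (H : AddSubgroup (Fin n → ZMod 2)) (c : Finset (Fin n → ZMod 2)),
      Nat.card H ≤ A.card ∧
      (c.card : ℝ) ≤ 2 * K ^ (12 : ℕ) ∧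
      (A : Set (Fin n → ZMod 2)) ⊆ (c : Set (Fin n → ZMod 2)) + (H : Set (Fin n → ZMod 2)) := by
  have h2 : (2 : Fin n → ZMod 2) = 0 := by funext i; rfl
  obtain ⟨H, B, hBA, hB, hBH, l1, l2, l3⟩ := ent_pfr h2 hA
    (fun x hx y hy => Finset.add_mem_add hx hy) hK hadd
  have hAc : (0 : ℝ) < A.card := by exact_mod_cast hA.card_pos
  have hBc : (0 : ℝ) < B.card := by exact_mod_cast hB.card_pos
  have hHc : (0 : ℝ) < Nat.card H := by exact_mod_cast Nat.card_pos
  have hK0 : 0 < K := by linarith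
  have hAB : ((A + B).card : ℝ) ≤ K * A.card / B.card * B.card := by
    rw [div_mul_cancel₀ _ hBc.ne']
    refine le_trans ?_ hadd
    exact_mod_cast Finset.card_le_card (Finset.add_subset_add_left hBA)
  obtain ⟨F, hFA, hF, hcov⟩ := Finset.ruzsa_covering_add hB hAB
  have hcovH : ∀ x ∈ A, ∃ f ∈ F, ∃ h ∈ H, f + h = x := by
    intro x hx
    obtain ⟨f, hf, d, hd, rfl⟩ := Finset.mem_add.1 (hcov hx)
    obtain ⟨b, hb, b', hb', rfl⟩ := Finset.mem_sub.1 hd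
    exact ⟨f, hf, _, hBH b hb b' hb', rfl⟩
  have hlog : Real.log (K * A.card / B.card) =
      Real.log K + Real.log A.card - Real.log B.card := by
    rw [Real.log_div (by positivity) (by positivity), Real.log_mul (by positivity) (by positivity)]
  have hKlog := Real.log_nonneg hK
  by_cases hle : Nat.card H ≤ A.card
  · refine ⟨H, F, hle, ?_, ?_⟩
    · refine hF.trans ?_
      rw [← Real.log_le_log_iff (by positivity) (by positivity), hlog,
        Real.log_mul (by positivity) (by positivity), Real.log_pow]
      have := Real.log_nonneg (show (1 : ℝ) ≤ 2 by norm_num)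
      push_cast
      linarith
    · intro x hx
      obtain ⟨f, hf, h, hh, rfl⟩ := hcovH x hx
      exact Set.add_mem_add hf hh
  · push Not at hle
    obtain ⟨H', c1, c2, c3⟩ := ZModModule.exists_submodule_subset_card_le Nat.prime_two
      (AddSubgroup.toZModSubmodule 2 H) (k := A.card) hle.le hA.card_pos.ne'
    classical
    let S : Finset (Fin n → ZMod 2) := Finset.univ.filter (· ∈ H)
    let S' : Finset (Fin n → ZMod 2) := Finset.univ.filter (· ∈ H')
    have eS : S.card = Nat.card H := by
      rw [Nat.card_eq_fintype_card, Fintype.card_subtype]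
    have eS' : S'.card = Nat.card H' := by
      rw [Nat.card_eq_fintype_card, Fintype.card_subtype]
    have hS' : S'.Nonempty := ⟨0, by simp [S']⟩
    have hS'c : (0 : ℝ) < S'.card := by exact_mod_cast hS'.card_pos
    have hSS : ((S + S').card : ℝ) ≤ S.card / S'.card * S'.card := by
      rw [div_mul_cancel₀ _ hS'c.ne']
      norm_cast
      refine Finset.card_le_card fun x hx => ?_
      obtain ⟨a, ha, b, hb, rfl⟩ := Finset.mem_add.1 hx
      simp only [S, S', Finset.mem_filter, Finset.mem_univ, true_and] at ha hb ⊢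
      exact H.add_mem ha (c3 hb)
    obtain ⟨F', -, hF', hcov'⟩ := Finset.ruzsa_covering_add hS' hSS
    refine ⟨H'.toAddSubgroup, F + F', c1, ?_, ?_⟩
    · have hcard : ((F + F').card : ℝ) ≤ F.card * F'.card := by exact_mod_cast Finset.card_add_le
      have hb : (S.card : ℝ) / S'.card ≤ 2 * Nat.card H / A.card := by
        rw [eS, div_le_div_iff₀ hS'c hAc, eS']
        have : (A.card : ℝ) ≤ 2 * Nat.card H' := by exact_mod_cast c2.le
        nlinarith
      have : ((F + F').card : ℝ) ≤ (K * A.card / B.card) * (2 * Nat.card H / A.card) :=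
        hcard.trans (mul_le_mul hF (hF'.trans hb) (by positivity) (by positivity))
      refine this.trans ?_
      rw [← Real.log_le_log_iff (by positivity) (by positivity),
        Real.log_mul (by positivity) (by positivity), hlog,
        Real.log_div (by positivity) (by positivity),
        Real.log_mul (by positivity) (by positivity),
        Real.log_mul (by positivity) (by positivity), Real.log_pow]
      push_cast
      linarith
    · intro x hx
      obtain ⟨f, hf, h, hh, rfl⟩ := hcovH x hx
      have hhS : h ∈ S := by simpa [S] using hh
      obtain ⟨f', hf', d, hd, rfl⟩ := Finset.mem_add.1 (hcov' hhS)
      obtain ⟨b, hb, b', hb', rfl⟩ := Finset.mem_sub.1 hd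
      simp only [S', Finset.mem_filter, Finset.mem_univ, true_and] at hb hb'
      rw [← add_assoc]
      exact Set.add_mem_add (Finset.mem_coe.2 (Finset.add_mem_add hf hf')) (H'.sub_mem hb hb')
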